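/- Let Γ be a multigraph and μ ⊆ E(Γ) a set of edges with h1(Γ_μ) > 0. Then there exists a unique subset ν ⊆ μ such that the subgraph Γ_ν is core and h1(Γ_ν) = h1(Γ_μ). Moreover ν is the union of all minimal subsets ξ ⊆ μ for which Γ_ξ contains a cycle; equivalently, ν is the union of the edge sets of all cycles of Γ_μ. -/

import Mathlib

open scoped Classical

/-- A multigraph: finite sets of vertices and edges, where each edge is
assigned an unordered pair of (possibly equal) endpoints. -/
structure Multigraph where
  V : Type
  E : Type
  finV : Finite V
  finE : Finite E
  ends : E → Sym2 V

attribute [instance] Multigraph.finV Multigraph.finE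

namespace Multigraph

variable (G : Multigraph)

/-- `v` and `w` are joined by some edge belonging to `μ`. -/
def Step (μ : Set G.E) (v w : G.V) : Prop :=
  ∃ e ∈ μ, G.ends e = s(v, w)

/-- Connectivity with respect to the edge set `μ`, as a setoid on all vertices. -/
def connSetoid (μ : Set G.E) : Setoid G.V :=
  Relation.EqvGen.setoid (G.Step μ)

/-- The number of connected components of the spanning subgraph `(V(G), μ)`. -/
noncomputable def h0 (μ : Set G.E) : ℕ :=
  Nat.card (Quotient (G.connSetoid μ))

/-- The first Betti number `h1 = |E| − |V| + h0` of the subgraph with edge set `μ`.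
(Isolated vertices contribute equally to `|V|` and to `h0`, so this agrees with
the first Betti number of the subgraph whose vertices are the endpoints of the
edges in `μ`.) -/
noncomputable def h1 (μ : Set G.E) : ℤ :=
  (Nat.card μ : ℤ) - (Nat.card G.V : ℤ) + (G.h0 μ : ℤ)

/-- A subgraph (identified with its edge set) is core (1PI): removing any one of
its edges lowers `h1`. -/
def IsCore (μ : Set G.E) : Prop :=
  ∀ e ∈ μ, G.h1 (μ \ {e}) < G.h1 μ

/-- The multigraph is connected. -/
def Connected : Prop := G.h0 Set.univ = 1

/-- The contraction `Γ//γ`: each connected component of `γ` is contracted to a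
single vertex and the edges of `γ` are deleted. -/
def contract (γ : Set G.E) : Multigraph where
  V := Quotient (G.connSetoid γ)
  E := {e : G.E // e ∉ γ}
  finV := Quotient.finite _
  finE := Subtype.finite
  ends e := (G.ends e.1).map (Quotient.mk (G.connSetoid γ))

/-- The subgraph with edge set `γ`, as a multigraph in its own right. -/
def restrict (γ : Set G.E) : Multigraph where
  V := G.V
  E := γ
  finV := G.finV
  finE := Subtype.finite
  ends e := G.ends e.1

/-- `F` is a spanning forest: it is acyclic and consists of one spanning tree of
each connected component (equivalently, it induces the same connectivity
relation as the full edge set). -/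
def IsSpanningForest (F : Set G.E) : Prop :=
  G.h1 F = 0 ∧ G.connSetoid F = G.connSetoid Set.univ

/-- The first Kirchhoff–Symanzik (graph) polynomial
`ψ(Γ) = Σ_F Π_{e ∉ F} A_e`, the sum over spanning forests. -/
noncomputable def kirchhoff : MvPolynomial G.E ℤ :=
  ∑ᶠ F ∈ {F : Set G.E | G.IsSpanningForest F}, ∏ᶠ e ∈ Fᶜ, MvPolynomial.X e

/-- Euclidean dot product on `ℝ^D`. -/
noncomputable def dot {D : ℕ} (x y : Fin D → ℝ) : ℝ := ∑ i, x i * y i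

/-- The total momentum entering the connected component `c` of `(V(G), F)`. -/
noncomputable def momentumOf {D : ℕ} (q : G.V → Fin D → ℝ) (F : Set G.E)
    (c : Quotient (G.connSetoid F)) : Fin D → ℝ :=
  ∑ᶠ v ∈ {v : G.V | Quotient.mk (G.connSetoid F) v = c}, q v

/-- The second Kirchhoff–Symanzik polynomial
`φ(Γ) = Σ_{(T₁,T₂)} (Q(T₁)·Q(T₂)) Π_{e ∉ T₁∪T₂} A_e`, the sum over spanning
2-forests, i.e. acyclic edge sets `F` with exactly two connected components
`T₁, T₂` (jointly covering all vertices); `Q(T_i)` is the sum of the momenta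
over the vertices of `T_i`, and `Q(T₁)·Q(T₂)` is computed symmetrically via
`Q(T₁)·Q(T₂) = ((Q(T₁)+Q(T₂))² − Q(T₁)² − Q(T₂)²)/2`. -/
noncomputable def symanzik2 (D : ℕ) (q : G.V → Fin D → ℝ) : MvPolynomial G.E ℝ :=
  ∑ᶠ F ∈ {F : Set G.E | G.h1 F = 0 ∧ G.h0 F = 2},
    MvPolynomial.C
      ((dot (∑ᶠ v, q v) (∑ᶠ v, q v) -
          ∑ᶠ c : Quotient (G.connSetoid F), dot (G.momentumOf q F c) (G.momentumOf q F c)) / 2) *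
      ∏ᶠ e ∈ Fᶜ, MvPolynomial.X e

/-- External momenta pass to the contraction `Γ//γ` by assigning to each vertex
(i.e. each connected component of `γ`, or untouched vertex) the sum of the
momenta of the vertices identified to it. -/
noncomputable def contractMomenta (γ : Set G.E) {D : ℕ} (q : G.V → Fin D → ℝ) :
    (G.contract γ).V → Fin D → ℝ :=
  fun c => ∑ᶠ v ∈ {v : G.V | Quotient.mk (G.connSetoid γ) v = c}, q v

/-- A flag of core subgraphs of the subgraph `γ`: a chain (under inclusion) of
nonempty core subgraphs of `γ`, having `γ` itself as its largest member.  We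
encode a flag as its set of members. -/
def IsCoreFlagIn (γ : Set G.E) (F : Set (Set G.E)) : Prop :=
  γ ∈ F ∧ ∅ ∉ F ∧ (∀ δ ∈ F, δ ⊆ γ ∧ G.IsCore δ) ∧ IsChain (· ⊆ ·) F

/-- A maximal flag of core subgraphs of `γ`: one admitting no refinement. -/
def IsMaximalCoreFlagIn (γ : Set G.E) (F : Set (Set G.E)) : Prop :=
  G.IsCoreFlagIn γ F ∧ ∀ F' : Set (Set G.E), G.IsCoreFlagIn γ F' → F ⊆ F' → F' = F

/-- A flag of core subgraphs of `Γ`. -/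
def IsCoreFlag (F : Set (Set G.E)) : Prop := G.IsCoreFlagIn Set.univ F

/-- A maximal flag of core subgraphs of `Γ`. -/
def IsMaximalCoreFlag (F : Set (Set G.E)) : Prop := G.IsMaximalCoreFlagIn Set.univ F

end Multigraph

namespace Multigraph

variable {G : Multigraph}

theorem connSetoid_mono {μ ν : Set G.E} (h : μ ⊆ ν) : G.connSetoid μ ≤ G.connSetoid ν := by
  refine Setoid.eqvGen_mono ?_
  rintro _ _ ⟨e, he, hs⟩
  exact ⟨e, h he, hs⟩

theorem connSetoid_le {μ : Set G.E} {s : Setoid G.V}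
    (h : ∀ e ∈ μ, ∀ v w, G.ends e = s(v, w) → s v w) : G.connSetoid μ ≤ s := by
  refine Setoid.eqvGen_le ?_
  rintro v w ⟨e, he, hs⟩
  exact h e he v w hs

theorem connSetoid_of_ends {μ : Set G.E} {e : G.E} (he : e ∈ μ) {v w : G.V}
    (h : G.ends e = s(v, w)) : G.connSetoid μ v w :=
  Relation.EqvGen.rel _ _ ⟨e, he, h⟩

/-- Removing an edge whose endpoints stay connected does not change connectivity. -/
theorem connSetoid_diff_singleton {μ : Set G.E} {e : G.E} {a b : G.V}
    (hab : G.ends e = s(a, b)) (h : G.connSetoid (μ \ {e}) a b) :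
    G.connSetoid (μ \ {e}) = G.connSetoid μ := by
  refine le_antisymm (connSetoid_mono Set.sdiff_subset) (connSetoid_le fun f hf v w hvw => ?_)
  by_cases hfe : f = e
  · subst hfe
    rw [hab, Sym2.eq_iff] at hvw
    rcases hvw with ⟨rfl, rfl⟩ | ⟨rfl, rfl⟩
    · exact h
    · exact Setoid.symm' _ h
  · exact connSetoid_of_ends (μ := μ \ {e}) ⟨hf, hfe⟩ hvw

/-- Identifying the classes of `b` and `a` in a setoid. -/
noncomputable def mergeSetoid {V : Type*} (s : Setoid V) (a b : V) : Setoid V :=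
  Setoid.comap (fun x => if s x b then Quotient.mk s a else Quotient.mk s x) ⊥

theorem connSetoid_le_mergeSetoid {μ : Set G.E} {e : G.E} {a b : G.V}
    (hab : G.ends e = s(a, b)) :
    G.connSetoid μ ≤ mergeSetoid (G.connSetoid (μ \ {e})) a b := by
  set s := G.connSetoid (μ \ {e}) with hs
  refine connSetoid_le fun f hf v w hvw => ?_
  change (if s v b then Quotient.mk s a else Quotient.mk s v)
    = (if s w b then Quotient.mk s a else Quotient.mk s w)
  by_cases hfe : f = e
  · subst hfe
    rw [hab, Sym2.eq_iff] at hvw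
    rcases hvw with ⟨rfl, rfl⟩ | ⟨rfl, rfl⟩ <;> simp
  · have h : s v w := connSetoid_of_ends (μ := μ \ {e}) ⟨hf, hfe⟩ hvw
    have hq : Quotient.mk s v = Quotient.mk s w := Quotient.sound h
    have hiff : s v b ↔ s w b := ⟨s.trans' (s.symm' h), s.trans' h⟩
    simp only [hiff, hq]

/-- Removing an edge whose endpoints become disconnected creates one new component. -/
theorem h0_diff_singleton {μ : Set G.E} {e : G.E} (he : e ∈ μ) {a b : G.V}
    (hab : G.ends e = s(a, b)) (h : ¬ G.connSetoid (μ \ {e}) a b) :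
    G.h0 (μ \ {e}) = G.h0 μ + 1 := by
  have hmerge := connSetoid_le_mergeSetoid (μ := μ) hab
  have hle : G.connSetoid (μ \ {e}) ≤ G.connSetoid μ := connSetoid_mono Set.sdiff_subset
  have hst : G.connSetoid μ a b := connSetoid_of_ends he hab
  unfold h0
  generalize G.connSetoid (μ \ {e}) = s at *
  generalize G.connSetoid μ = t at *
  let f : {q : Quotient s // q ≠ Quotient.mk s b} → Quotient t :=
    fun q => Quotient.map' id (fun _ _ hxy => hle hxy) q.1
  have hf : Function.Bijective f := by
    constructor
    · rintro ⟨⟨x⟩, hx⟩ ⟨⟨y⟩, hy⟩ hxy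
      have hxb : ¬ s x b := fun h' => hx (Quotient.sound h')
      have hyb : ¬ s y b := fun h' => hy (Quotient.sound h')
      have h1 : (if s x b then Quotient.mk s a else Quotient.mk s x)
          = (if s y b then Quotient.mk s a else Quotient.mk s y) :=
        hmerge (Quotient.exact hxy)
      rw [if_neg hxb, if_neg hyb] at h1
      exact Subtype.ext h1
    · rintro ⟨x⟩
      by_cases hx : s x b
      · exact ⟨⟨Quotient.mk s a, fun h' => h (Quotient.exact h')⟩,
          Quotient.sound (t.trans' hst (t.symm' (hle hx)))⟩
      · exact ⟨⟨Quotient.mk s x, fun h' => hx (Quotient.exact h')⟩, rfl⟩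
  rw [← Nat.card_congr (Equiv.ofBijective f hf)]
  have := Set.ncard_sdiff_singleton_add_one (Set.mem_univ (Quotient.mk s b))
  rw [Set.ncard_univ] at this
  rw [← this, ← Nat.card_coe_set_eq]
  congr 1
  exact Nat.card_congr (Equiv.subtypeEquivRight (by simp))

theorem card_diff_singleton_add_one {μ : Set G.E} {e : G.E} (he : e ∈ μ) :
    Nat.card ↥(μ \ {e}) + 1 = Nat.card μ := by
  simpa only [Nat.card_coe_set_eq] using Set.ncard_sdiff_singleton_add_one he

theorem h1_diff_singleton_of_conn {μ : Set G.E} {e : G.E} (he : e ∈ μ) {a b : G.V}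
    (hab : G.ends e = s(a, b)) (h : G.connSetoid (μ \ {e}) a b) :
    G.h1 (μ \ {e}) = G.h1 μ - 1 := by
  have h0 : G.h0 (μ \ {e}) = G.h0 μ := by unfold h0; rw [connSetoid_diff_singleton hab h]
  have := card_diff_singleton_add_one he
  unfold h1
  omega

theorem h1_diff_singleton_of_not_conn {μ : Set G.E} {e : G.E} (he : e ∈ μ) {a b : G.V}
    (hab : G.ends e = s(a, b)) (h : ¬ G.connSetoid (μ \ {e}) a b) :
    G.h1 (μ \ {e}) = G.h1 μ := by
  have h0 := h0_diff_singleton he hab h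
  have := card_diff_singleton_add_one he
  unfold h1
  omega

theorem h1_diff_singleton (μ : Set G.E) (e : G.E) :
    G.h1 (μ \ {e}) = G.h1 μ ∨ G.h1 (μ \ {e}) = G.h1 μ - 1 := by
  by_cases he : e ∈ μ
  · obtain ⟨a, b, hab⟩ : ∃ a b, G.ends e = s(a, b) :=
      Sym2.ind (fun a b => ⟨a, b, rfl⟩) (G.ends e)
    by_cases h : G.connSetoid (μ \ {e}) a b
    · exact .inr (h1_diff_singleton_of_conn he hab h)
    · exact .inl (h1_diff_singleton_of_not_conn he hab h)
  · exact .inl (by rw [Set.sdiff_singleton_eq_self he])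

/-- An edge that is not a bridge of a subgraph is not a bridge of any larger subgraph. -/
theorem h1_diff_singleton_lt_mono {μ ν : Set G.E} (hνμ : ν ⊆ μ) {e : G.E} (he : e ∈ ν)
    (h : G.h1 (ν \ {e}) < G.h1 ν) : G.h1 (μ \ {e}) < G.h1 μ := by
  obtain ⟨a, b, hab⟩ : ∃ a b, G.ends e = s(a, b) :=
    Sym2.ind (fun a b => ⟨a, b, rfl⟩) (G.ends e)
  have hconn : G.connSetoid (ν \ {e}) a b := by
    by_contra hc
    exact h.ne (h1_diff_singleton_of_not_conn he hab hc)
  have := h1_diff_singleton_of_conn (hνμ he) hab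
    (connSetoid_mono (Set.sdiff_subset_sdiff_left hνμ) hconn)
  omega

theorem h1_empty : G.h1 ∅ = 0 := by
  have h : G.connSetoid ∅ ≤ ⊥ := connSetoid_le fun e he => absurd he (Set.notMem_empty e)
  have hb : Function.Bijective (Quotient.mk (G.connSetoid ∅)) :=
    ⟨fun x y hxy => h (Quotient.exact hxy), Quotient.mk_surjective⟩
  have := Nat.card_congr (Equiv.ofBijective _ hb)
  simp [h1, h0, this]

theorem h1_mono {μ ν : Set G.E} (h : ν ⊆ μ) : G.h1 ν ≤ G.h1 μ := by
  obtain ⟨κ, ⟨hνκ, hκμ, hκ⟩, hmin⟩ :=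
    (Set.toFinite {κ : Set G.E | ν ⊆ κ ∧ κ ⊆ μ ∧ G.h1 κ ≤ G.h1 μ}).exists_minimal
      ⟨μ, h, subset_rfl, le_rfl⟩
  suffices κ ⊆ ν from (subset_antisymm this hνκ) ▸ hκ
  intro e he
  by_contra heν
  have hle : G.h1 (κ \ {e}) ≤ G.h1 μ := by
    rcases G.h1_diff_singleton κ e with h' | h' <;> omega
  exact (hmin ⟨Set.subset_sdiff_singleton hνκ heν, Set.sdiff_subset.trans hκμ, hle⟩
    Set.sdiff_subset he).2 rfl

theorem exists_core (μ : Set G.E) : ∃ ν ⊆ μ, G.IsCore ν ∧ G.h1 ν = G.h1 μ := by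
  obtain ⟨ν, ⟨hνμ, hν⟩, hmin⟩ :=
    (Set.toFinite {ν : Set G.E | ν ⊆ μ ∧ G.h1 ν = G.h1 μ}).exists_minimal ⟨μ, subset_rfl, rfl⟩
  refine ⟨ν, hνμ, fun e he => (h1_mono Set.sdiff_subset).lt_of_ne fun heq => ?_, hν⟩
  exact (hmin ⟨Set.sdiff_subset.trans hνμ, heq.trans hν⟩ Set.sdiff_subset he).2 rfl

/-- A core subgraph of full Betti number consists of the non-bridges. -/
theorem IsCore.eq_setOf {μ ν : Set G.E} (hνμ : ν ⊆ μ) (hν : G.IsCore ν)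
    (h : G.h1 ν = G.h1 μ) : ν = {e ∈ μ | G.h1 (μ \ {e}) < G.h1 μ} := by
  ext e
  refine ⟨fun he => ⟨hνμ he, h1_diff_singleton_lt_mono hνμ he (hν e he)⟩, fun ⟨_, hlt⟩ => ?_⟩
  by_contra heν
  have := h1_mono (Set.subset_sdiff_singleton hνμ heν)
  omega

theorem minimal_iff_cycle (ξ : Set G.E) :
    (0 < G.h1 ξ ∧ ∀ ξ' : Set G.E, ξ' ⊂ ξ → ¬ 0 < G.h1 ξ') ↔ G.IsCore ξ ∧ G.h1 ξ = 1 := by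
  constructor
  · rintro ⟨hpos, hmin⟩
    have hdiff : ∀ e ∈ ξ, G.h1 (ξ \ {e}) ≤ 0 := fun e he =>
      not_lt.1 (hmin _ (Set.sdiff_singleton_ssubset.2 he))
    refine ⟨fun e he => (hdiff e he).trans_lt hpos, ?_⟩
    obtain ⟨e, he⟩ : ξ.Nonempty := by
      rw [Set.nonempty_iff_ne_empty]
      rintro rfl
      exact hpos.ne' h1_empty
    have := hdiff e he
    rcases G.h1_diff_singleton ξ e with h' | h' <;> omega
  · rintro ⟨hcore, hone⟩
    refine ⟨by omega, fun ξ' hss => ?_⟩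
    obtain ⟨e, he, heξ'⟩ := Set.exists_of_ssubset hss
    have := h1_mono (Set.subset_sdiff_singleton hss.subset heξ')
    have := hcore e he
    omega

theorem h1_eq_zero_of_forall {μ : Set G.E} (h : ∀ e ∈ μ, G.h1 (μ \ {e}) = G.h1 μ) :
    G.h1 μ = 0 := by
  obtain ⟨ν, hνμ, hν, heq⟩ := exists_core μ
  rw [hν.eq_setOf hνμ heq] at heq
  rw [← heq, ← h1_empty (G := G)]
  congr 1
  ext e
  simp only [Set.mem_ofPred_eq, Set.mem_empty_iff_false, iff_false, not_and, not_lt]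
  exact fun he => (h e he).ge

/-- Every edge that is not a bridge lies on a cycle. -/
theorem exists_cycle {μ : Set G.E} {e : G.E} (he : e ∈ μ) (h : G.h1 (μ \ {e}) < G.h1 μ) :
    ∃ ξ ⊆ μ, e ∈ ξ ∧ G.IsCore ξ ∧ G.h1 ξ = 1 := by
  obtain ⟨ξ, ⟨hξμ, heξ, hξ⟩, hmin⟩ :=
    (Set.toFinite {ξ : Set G.E | ξ ⊆ μ ∧ e ∈ ξ ∧ G.h1 (ξ \ {e}) < G.h1 ξ}).exists_minimal
      ⟨μ, subset_rfl, he, h⟩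
  have hbridge : ∀ f ∈ ξ, f ≠ e → G.h1 ((ξ \ {e}) \ {f}) = G.h1 (ξ \ {f}) := by
    intro f hf hfe
    rw [Set.sdiff_sdiff_comm]
    refine (h1_mono Set.sdiff_subset).antisymm (not_lt.1 fun hlt => ?_)
    have heξf : e ∈ ξ \ {f} := ⟨heξ, fun hef => hfe hef.symm⟩
    exact (hmin ⟨Set.sdiff_subset.trans hξμ, heξf, hlt⟩ Set.sdiff_subset hf).2 rfl
  have hzero : G.h1 (ξ \ {e}) = 0 := by
    refine h1_eq_zero_of_forall fun f hf => ?_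
    have := hbridge f hf.1 hf.2
    rcases G.h1_diff_singleton ξ f with h' | h' <;>
      rcases G.h1_diff_singleton (ξ \ {e}) f with h'' | h'' <;> omega
  have hone : G.h1 ξ = 1 := by
    rcases G.h1_diff_singleton ξ e with h' | h' <;> omega
  refine ⟨ξ, hξμ, heξ, fun f hf => ?_, hone⟩
  by_cases hfe : f = e
  · exact hfe ▸ hξ
  · have := hbridge f hf hfe
    have := h1_mono (Set.sdiff_subset : (ξ \ {e}) \ {f} ⊆ ξ \ {e})
    omega

end Multigraph

/-- if `h1(Γ_μ) > 0` there is a unique `ν ⊆ μ` with `Γ_ν` core and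
`h1(Γ_ν) = h1(Γ_μ)`; moreover `ν` is the union of all minimal subsets
`ξ ⊆ μ` whose subgraph contains a cycle, equivalently the union of the edge
sets of all cycles (core subgraphs with `h1 = 1`) of `Γ_μ`. -/
theorem existsUnique_core_with_same_h1 (G : Multigraph) (μ : Set G.E)
    (hμ : 0 < G.h1 μ) :
    (∃! ν : Set G.E, ν ⊆ μ ∧ G.IsCore ν ∧ G.h1 ν = G.h1 μ) ∧
      ∀ ν : Set G.E, ν ⊆ μ → G.IsCore ν → G.h1 ν = G.h1 μ →
        ν = ⋃₀ {ξ : Set G.E | ξ ⊆ μ ∧ 0 < G.h1 ξ ∧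
                ∀ ξ' : Set G.E, ξ' ⊂ ξ → ¬ 0 < G.h1 ξ'} ∧
        ν = ⋃₀ {ξ : Set G.E | ξ ⊆ μ ∧ G.IsCore ξ ∧ G.h1 ξ = 1} := by
  refine ⟨?_, fun ν hνμ hν h => ?_⟩
  · obtain ⟨ν, hνμ, hν, h⟩ := Multigraph.exists_core μ
    refine ⟨ν, ⟨hνμ, hν, h⟩, fun ν' ⟨hνμ', hν', h'⟩ => ?_⟩
    rw [hν.eq_setOf hνμ h, hν'.eq_setOf hνμ' h']
  · simp only [Multigraph.minimal_iff_cycle, and_self]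
    ext e
    constructor
    · intro he
      obtain ⟨ξ, hξν, heξ, hξ⟩ := Multigraph.exists_cycle he (hν e he)
      exact ⟨ξ, ⟨hξν.trans hνμ, hξ⟩, heξ⟩
    · rintro ⟨ξ, ⟨hξμ, hξ, -⟩, heξ⟩
      rw [hν.eq_setOf hνμ h]
      exact ⟨hξμ heξ, Multigraph.h1_diff_singleton_lt_mono hξμ heξ (hξ e heξ)⟩
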